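/- Let Λ be an even lattice containing at least three orthogonal copies of the hyperbolic plane U, written as Λ = U ⊕ Λ₁ with standard basis {e, f} of the distinguished copy U. Fix integers s, r, p > 1 and set h₁ = e + r·f, h₂ = e + (r−1)·f, h₃ = s·e + p·f, h₄ = (s−1)·e + p·f. Then the group O⁺(Λ) of orientation-preserving isometries of Λ is generated by the stabilizer subgroups O⁺(Λ)_{h₁}, O⁺(Λ)_{h₂}, O⁺(Λ)_{h₃}, O⁺(Λ)_{h₄}. -/

import Mathlib

open TensorProduct

section Orientation

variable {V : Type*} [AddCommGroup V] [Module ℝ V]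

/-- The bilinear form `Bv` is positive definite on the subspace `W`. -/
def PosDefOn (Bv : LinearMap.BilinForm ℝ V) (W : Submodule ℝ V) : Prop :=
  ∀ x ∈ W, x ≠ 0 → 0 < Bv x x

/-- `W` is a maximal positive-definite subspace for `Bv`. -/
def MaxPosDef (Bv : LinearMap.BilinForm ℝ V) (W : Submodule ℝ V) : Prop :=
  PosDefOn Bv W ∧ ∀ W' : Submodule ℝ V, PosDefOn Bv W' → W ≤ W' → W' = W

/-- `p` is the `Bv`-orthogonal projection of `V` onto `W`. -/
def IsOrthoProj (Bv : LinearMap.BilinForm ℝ V) (W : Submodule ℝ V)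
    (p : V →ₗ[ℝ] W) : Prop :=
  (∀ w : V, w ∈ W → (p w : V) = w) ∧ ∀ x : V, (∀ u ∈ W, Bv x u = 0) → p x = 0

/-- A linear endomorphism `gv` of a real quadratic space is orientation preserving if,
for every maximal positive-definite subspace `W` and the orthogonal projection `p`
onto `W`, the composite `p ∘ gv |_W : W → W` has positive determinant. -/
def OrientationPreserving (Bv : LinearMap.BilinForm ℝ V) (gv : V →ₗ[ℝ] V) : Prop :=
  ∀ W : Submodule ℝ V, MaxPosDef Bv W → ∀ p : V →ₗ[ℝ] W, IsOrthoProj Bv W p →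
    0 < LinearMap.det ((p ∘ₗ gv) ∘ₗ W.subtype)

end Orientation

variable {M : Type*} [AddCommGroup M] [Module ℤ M]

/-- Membership in `O⁺(Λ)`: an isometry of the lattice `(M,B)` whose real extension
preserves the orientation of maximal positive-definite subspaces of `M ⊗ ℝ`. -/
def IsOPlus (B : M →ₗ[ℤ] M →ₗ[ℤ] ℤ) (g : M ≃ₗ[ℤ] M) : Prop :=
  (∀ x y, B (g x) (g y) = B x y) ∧
  OrientationPreserving (LinearMap.BilinForm.baseChange ℝ B)
    ((↑g : M →ₗ[ℤ] M).baseChange ℝ)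

set_option linter.unusedSectionVars false
set_option linter.unusedSimpArgs false

section RealPart

variable {V : Type*} [AddCommGroup V] [Module ℝ V] [Module.Finite ℝ V]

lemma sub_proj_orth (Bv : LinearMap.BilinForm ℝ V) (hs : ∀ x y, Bv x y = Bv y x)
    (W : Submodule ℝ V) (hW : MaxPosDef Bv W) (p : V →ₗ[ℝ] W) (hp : IsOrthoProj Bv W p)
    (x : V) : ∀ u ∈ W, Bv (x - p x) u = 0 := by
  have hrefl : Bv.IsRefl := fun a b h => by rw [hs]; exact h
  have hnd : (Bv.restrict W).Nondegenerate := by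
    have : (Bv.restrict W).IsRefl := fun a b h => by
      simp only [LinearMap.BilinForm.restrict_apply] at h ⊢
      exact hrefl _ _ h
    refine (LinearMap.IsRefl.nondegenerate_iff_separatingLeft this).2 ?_
    intro a ha
    by_contra hne
    have h1 := hW.1 a a.2 (by simpa using hne)
    have h2 := ha a
    simp only [LinearMap.BilinForm.restrict_apply] at h2
    simp at h2
    linarith
  have hc := LinearMap.BilinForm.isCompl_orthogonal_of_restrict_nondegenerate hrefl hnd
  have hx : x ∈ W ⊔ Bv.orthogonal W := by rw [hc.sup_eq_top]; trivial
  obtain ⟨w, hw, y, hy, rfl⟩ := Submodule.mem_sup.1 hx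
  have hy' : ∀ u ∈ W, Bv y u = 0 := fun u hu => by
    rw [hs]; exact hy u hu
  intro u hu
  rw [map_add, hp.2 y hy', add_zero, hp.1 w hw]
  simpa using hy' u hu

lemma nonpos_of_orth (Bv : LinearMap.BilinForm ℝ V) (hs : ∀ x y, Bv x y = Bv y x)
    (W : Submodule ℝ V) (hW : MaxPosDef Bv W) (y : V) (hy : ∀ u ∈ W, Bv y u = 0) :
    Bv y y ≤ 0 := by
  by_contra hpos
  push Not at hpos
  have h1 : PosDefOn Bv (W ⊔ Submodule.span ℝ {y}) := by
    intro x hx hx0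
    obtain ⟨w, hw, z, hz, rfl⟩ := Submodule.mem_sup.1 hx
    obtain ⟨c, rfl⟩ := Submodule.mem_span_singleton.1 hz
    have e1 : Bv (w + c • y) (w + c • y) = Bv w w + c ^ 2 * Bv y y := by
      have h2 := hy w hw
      have h3 : Bv w y = 0 := by rw [hs]; exact h2
      simp only [map_add, map_smul, LinearMap.add_apply, LinearMap.smul_apply, smul_eq_mul, h2, h3]
      ring
    rw [e1]
    by_cases hw0 : w = 0
    · subst hw0
      have hc : c ≠ 0 := by
        rintro rfl
        simp at hx0
      have : 0 < c ^ 2 := by positivity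
      simp only [map_zero, zero_add]
      positivity
    · have := hW.1 w hw hw0
      positivity
  have h2 := hW.2 _ h1 le_sup_left
  have h3 : y ∈ W := by
    rw [← h2]
    exact Submodule.mem_sup_right (Submodule.mem_span_singleton_self y)
  have := hy y h3
  linarith

lemma proj_ne_zero (Bv : LinearMap.BilinForm ℝ V) (hs : ∀ x y, Bv x y = Bv y x)
    (W : Submodule ℝ V) (hW : MaxPosDef Bv W) (p : V →ₗ[ℝ] W) (hp : IsOrthoProj Bv W p)
    (x : V) (hx : 0 < Bv x x) : p x ≠ 0 := by
  intro h
  have h1 := sub_proj_orth Bv hs W hW p hp x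
  have h2 := nonpos_of_orth Bv hs W hW _ h1
  rw [h] at h2
  simp at h2
  linarith

/-- Determinants along a quadratic path of injective endomorphisms have constant sign. -/
lemma det_path {W : Type*} [AddCommGroup W] [Module ℝ W] [Module.Finite ℝ W]
    (A C D : W →ₗ[ℝ] W)
    (h : ∀ t : ℝ, 0 ≤ t → t ≤ 1 → ∀ x, (A + t • C + t ^ 2 • D) x = 0 → x = 0) :
    0 < LinearMap.det A * LinearMap.det (A + C + D) := by
  classical
  let b := Module.finBasis ℝ W
  let F : ℝ → ℝ := fun t => LinearMap.det (A + t • C + t ^ 2 • D)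
  have hF : Continuous F := by
    have : F = fun t => (LinearMap.toMatrix b b A + t • LinearMap.toMatrix b b C
        + t ^ 2 • LinearMap.toMatrix b b D).det := by
      funext t
      simp only [F]
      rw [← LinearMap.det_toMatrix b]
      simp only [map_add, map_smul]
    rw [this]
    apply Continuous.matrix_det
    fun_prop
  have hne : ∀ t ∈ Set.Icc (0:ℝ) 1, F t ≠ 0 := by
    intro t ht h0
    have := LinearMap.bot_lt_ker_of_det_eq_zero h0
    obtain ⟨x, hx, hx0⟩ := Submodule.exists_mem_ne_zero_of_ne_bot this.ne'
    exact hx0 (h t ht.1 ht.2 x hx)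
  have e0 : F 0 = LinearMap.det A := by simp [F]
  have e1 : F 1 = LinearMap.det (A + C + D) := by simp [F]
  rw [← e0, ← e1]
  have h0 := hne 0 (by simp)
  have h1 := hne 1 (by simp)
  rcases lt_or_gt_of_ne h0 with h0 | h0 <;> rcases lt_or_gt_of_ne h1 with h1 | h1
  · exact mul_pos_of_neg_of_neg h0 h1
  · exfalso
    obtain ⟨t, ht, h2⟩ := intermediate_value_Icc (zero_le_one' ℝ) hF.continuousOn
      (show (0:ℝ) ∈ Set.Icc (F 0) (F 1) from ⟨h0.le, h1.le⟩)
    exact hne t ht h2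
  · exfalso
    obtain ⟨t, ht, h2⟩ := intermediate_value_Icc' (zero_le_one' ℝ) hF.continuousOn
      (show (0:ℝ) ∈ Set.Icc (F 1) (F 0) from ⟨h1.le, h0.le⟩)
    exact hne t ht h2
  · exact mul_pos h0 h1

lemma det_mul_sign (Bv : LinearMap.BilinForm ℝ V) (hs : ∀ x y, Bv x y = Bv y x)
    (W : Submodule ℝ V) (hW : MaxPosDef Bv W) (p : V →ₗ[ℝ] W) (hp : IsOrthoProj Bv W p)
    (g h : V →ₗ[ℝ] V) (hg : ∀ x y, Bv (g x) (g y) = Bv x y)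
    (hh : ∀ x y, Bv (h x) (h y) = Bv x y) :
    0 < LinearMap.det ((p ∘ₗ g) ∘ₗ W.subtype) * LinearMap.det ((p ∘ₗ h) ∘ₗ W.subtype) *
      LinearMap.det ((p ∘ₗ (g ∘ₗ h)) ∘ₗ W.subtype) := by
  have key := det_path (((p ∘ₗ g) ∘ₗ W.subtype) ∘ₗ ((p ∘ₗ h) ∘ₗ W.subtype))
    ((p ∘ₗ (g ∘ₗ h)) ∘ₗ W.subtype - ((p ∘ₗ g) ∘ₗ W.subtype) ∘ₗ ((p ∘ₗ h) ∘ₗ W.subtype)) 0 ?_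
  · rw [LinearMap.det_comp] at key
    convert key using 3
    abel
  · intro t ht0 ht1 x hx
    by_contra hx0
    have hxp : 0 < Bv x x := hW.1 x x.2 (by simpa using hx0)
    set q : V := (p (h x) : V) with hq
    set u : V := h x - q with hu
    have hor := sub_proj_orth Bv hs W hW p hp (h x)
    have hun := nonpos_of_orth Bv hs W hW u hor
    have huq : Bv u q = 0 := hor q (p (h x)).2
    have hqu : Bv q u = 0 := by rw [hs]; exact huq
    have hhx : h x = q + u := by simp [hu]
    have e1 : Bv q q + Bv u u = Bv x x := by
      rw [← hh x x, hhx]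
      simp only [map_add, LinearMap.add_apply, huq, hqu]
      ring
    have e2 : Bv (q + t • u) (q + t • u) = Bv q q + t ^ 2 * Bv u u := by
      simp only [map_add, map_smul, LinearMap.add_apply, LinearMap.smul_apply, smul_eq_mul, huq, hqu]
      ring
    have e3 : 0 < Bv (g (q + t • u)) (g (q + t • u)) := by
      rw [hg, e2]
      nlinarith [mul_nonneg (neg_nonneg.2 hun) (by nlinarith : (0:ℝ) ≤ 1 - t ^ 2)]
    apply proj_ne_zero Bv hs W hW p hp _ e3
    rw [← hx]
    simp only [LinearMap.add_apply, LinearMap.smul_apply, LinearMap.sub_apply, LinearMap.comp_apply,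
      Submodule.subtype_apply, LinearMap.zero_apply, smul_zero, add_zero, ← hq]
    rw [hhx]
    simp only [map_add, map_smul, add_sub_cancel_left]

lemma orient_id (Bv : LinearMap.BilinForm ℝ V) : OrientationPreserving Bv LinearMap.id := by
  intro W hW p hp
  have : ((p ∘ₗ LinearMap.id) ∘ₗ W.subtype) = LinearMap.id := by
    ext x
    simp [hp.1 x x.2]
  rw [this, LinearMap.det_id]
  exact one_pos

lemma orient_comp (Bv : LinearMap.BilinForm ℝ V) (hs : ∀ x y, Bv x y = Bv y x)
    (g h : V →ₗ[ℝ] V) (hg : ∀ x y, Bv (g x) (g y) = Bv x y)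
    (hh : ∀ x y, Bv (h x) (h y) = Bv x y) (og : OrientationPreserving Bv g)
    (oh : OrientationPreserving Bv h) : OrientationPreserving Bv (g ∘ₗ h) := by
  intro W hW p hp
  have h1 := det_mul_sign Bv hs W hW p hp g h hg hh
  exact pos_of_mul_pos_right h1 (mul_pos (og W hW p hp) (oh W hW p hp)).le

lemma orient_inv (Bv : LinearMap.BilinForm ℝ V) (hs : ∀ x y, Bv x y = Bv y x)
    (g h : V →ₗ[ℝ] V) (hg : ∀ x y, Bv (g x) (g y) = Bv x y)
    (hh : ∀ x y, Bv (h x) (h y) = Bv x y) (og : OrientationPreserving Bv g)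
    (hgh : g ∘ₗ h = LinearMap.id) : OrientationPreserving Bv h := by
  intro W hW p hp
  have h1 := det_mul_sign Bv hs W hW p hp g h hg hh
  rw [hgh] at h1
  have h2 := pos_of_mul_pos_left h1 (orient_id Bv W hW p hp).le
  exact pos_of_mul_pos_right h2 (og W hW p hp).le

/-- Real Eichler transvections preserve the orientation. -/
lemma orient_transv (Bv : LinearMap.BilinForm ℝ V) (hs : ∀ x y, Bv x y = Bv y x)
    (z a : V) (n : ℝ) (hz : Bv z z = 0) (hza : Bv z a = 0) (hn : Bv a a = 2 * n)
    (g : V →ₗ[ℝ] V)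
    (hg : ∀ v, g v = v - Bv a v • z + Bv z v • a - (n * Bv z v) • z) :
    OrientationPreserving Bv g := by
  intro W hW p hp
  have haz : Bv a z = 0 := by rw [hs]; exact hza
  let N : V →ₗ[ℝ] V := - (Bv a).smulRight z + (Bv z).smulRight a
  let C : V →ₗ[ℝ] V := - (n • (Bv z).smulRight z)
  have key := det_path ((p ∘ₗ LinearMap.id) ∘ₗ W.subtype) ((p ∘ₗ N) ∘ₗ W.subtype)
    ((p ∘ₗ C) ∘ₗ W.subtype) ?_
  · have hgN : (p ∘ₗ g) ∘ₗ W.subtype = (p ∘ₗ LinearMap.id) ∘ₗ W.subtype + (p ∘ₗ N) ∘ₗ W.subtype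
        + (p ∘ₗ C) ∘ₗ W.subtype := by
      have : g = LinearMap.id + N + C := by
        ext v
        rw [hg]
        simp only [N, C, LinearMap.add_apply, LinearMap.neg_apply, LinearMap.smulRight_apply,
          LinearMap.smul_apply, LinearMap.id_apply]
        module
      rw [this]
      simp only [LinearMap.comp_add, LinearMap.add_comp]
    rw [hgN]
    exact pos_of_mul_pos_right key (orient_id Bv W hW p hp).le
  · intro t _ _ x hx
    by_contra hx0
    have hxp : 0 < Bv x x := hW.1 x x.2 (by simpa using hx0)
    let y : V := x + t • N x + t ^ 2 • C x
    have hy : Bv y y = Bv x x := by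
      have h1 := hs x z
      have h2 := hs x a
      simp only [y, N, C, LinearMap.add_apply, LinearMap.neg_apply, LinearMap.smulRight_apply,
          LinearMap.smul_apply, map_add, map_neg, map_smul, smul_eq_mul, hz, hza, haz, hn, h1, h2]
      ring
    apply proj_ne_zero Bv hs W hW p hp y (by rw [hy]; exact hxp)
    rw [← hx]
    simp [y]

end RealPart

section LatticePart

variable {K : Type*} [AddCommGroup K] [Module.Finite ℤ K]

lemma bc_symm (B : K →ₗ[ℤ] K →ₗ[ℤ] ℤ) (hsymm : ∀ x y, B x y = B y x) (x y : ℝ ⊗[ℤ] K) :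
    LinearMap.BilinForm.baseChange ℝ B x y = LinearMap.BilinForm.baseChange ℝ B y x := by
  induction x with
  | zero => simp
  | add x1 x2 h1 h2 => simp only [map_add, LinearMap.add_apply, h1, h2]
  | tmul a m =>
    induction y with
    | zero => simp
    | add x1 x2 h1 h2 => simp only [map_add, LinearMap.add_apply, h1, h2]
    | tmul b n =>
      simp only [LinearMap.BilinForm.baseChange_tmul, hsymm m n, mul_comm a b]

lemma bc_isom (B : K →ₗ[ℤ] K →ₗ[ℤ] ℤ) (g : K →ₗ[ℤ] K)
    (hg : ∀ x y, B (g x) (g y) = B x y) (x y : ℝ ⊗[ℤ] K) :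
    LinearMap.BilinForm.baseChange ℝ B (g.baseChange ℝ x) (g.baseChange ℝ y) =
      LinearMap.BilinForm.baseChange ℝ B x y := by
  induction x with
  | zero => simp
  | add x1 x2 h1 h2 => simp only [map_add, LinearMap.add_apply, h1, h2]
  | tmul a m =>
    induction y with
    | zero => simp
    | add x1 x2 h1 h2 => simp only [map_add, h1, h2]
    | tmul b n =>
      simp only [LinearMap.baseChange_tmul, LinearMap.BilinForm.baseChange_tmul, hg]

lemma oplus_one (B : K →ₗ[ℤ] K →ₗ[ℤ] ℤ) : IsOPlus B (1 : K ≃ₗ[ℤ] K) := by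
  refine ⟨fun x y => rfl, ?_⟩
  have : ((↑(1 : K ≃ₗ[ℤ] K) : K →ₗ[ℤ] K).baseChange ℝ) = LinearMap.id := by
    ext x; simp
  rw [this]
  exact orient_id _

lemma oplus_mul (B : K →ₗ[ℤ] K →ₗ[ℤ] ℤ) (hsymm : ∀ x y, B x y = B y x)
    (g h : K ≃ₗ[ℤ] K) (hg : IsOPlus B g) (hh : IsOPlus B h) : IsOPlus B (g * h) := by
  refine ⟨fun x y => ?_, ?_⟩
  · rw [LinearEquiv.mul_apply, LinearEquiv.mul_apply, hg.1, hh.1]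
  have : ((↑(g * h : K ≃ₗ[ℤ] K) : K →ₗ[ℤ] K).baseChange ℝ) =
      ((↑g : K →ₗ[ℤ] K).baseChange ℝ) ∘ₗ ((↑h : K →ₗ[ℤ] K).baseChange ℝ) := by
    ext x; simp
  rw [this]
  exact orient_comp _ (bc_symm B hsymm) _ _ (bc_isom B _ hg.1) (bc_isom B _ hh.1) hg.2 hh.2

lemma oplus_inv (B : K →ₗ[ℤ] K →ₗ[ℤ] ℤ) (hsymm : ∀ x y, B x y = B y x)
    (g : K ≃ₗ[ℤ] K) (hg : IsOPlus B g) : IsOPlus B g⁻¹ := by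
  have hi : ∀ x, g (g⁻¹ x) = x := fun x => by
    rw [← LinearEquiv.mul_apply, mul_inv_cancel]; rfl
  have h1 : ∀ x y, B (g⁻¹ x) (g⁻¹ y) = B x y := fun x y => by
    rw [← hg.1, hi, hi]
  refine ⟨h1, ?_⟩
  refine orient_inv _ (bc_symm B hsymm) _ _ (bc_isom B _ hg.1) (bc_isom B _ h1) hg.2 ?_
  ext x
  simp [hi]

/-- Eichler transvection as a linear map. -/
def eichL (B : K →ₗ[ℤ] K →ₗ[ℤ] ℤ) (z a : K) (n : ℤ) : K →ₗ[ℤ] K :=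
  LinearMap.id - (B a).smulRight z + (B z).smulRight a - n • (B z).smulRight z

lemma eichL_apply (B : K →ₗ[ℤ] K →ₗ[ℤ] ℤ) (z a : K) (n : ℤ) (v : K) :
    eichL B z a n v = v - B a v • z + B z v • a - (n * B z v) • z := by
  simp only [eichL, LinearMap.sub_apply, LinearMap.add_apply, LinearMap.id_apply,
    LinearMap.smulRight_apply, LinearMap.smul_apply, mul_smul]

lemma eichL_inv (B : K →ₗ[ℤ] K →ₗ[ℤ] ℤ) (hsymm : ∀ x y, B x y = B y x) (z a : K) (n : ℤ)
    (hz : B z z = 0) (hza : B z a = 0) (hn : B a a = 2 * n) :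
    eichL B z a n ∘ₗ eichL B z (-a) n = LinearMap.id := by
  have haz : B a z = 0 := by rw [hsymm]; exact hza
  ext v
  simp only [LinearMap.comp_apply, eichL_apply, map_add, map_sub, map_smul, map_neg,
    LinearMap.neg_apply, smul_eq_mul, hz, hza, haz, hn, LinearMap.id_apply]
  module

/-- Eichler transvection as an isometry. -/
def eich (B : K →ₗ[ℤ] K →ₗ[ℤ] ℤ) (hsymm : ∀ x y, B x y = B y x) (z a : K) (n : ℤ)
    (hz : B z z = 0) (hza : B z a = 0) (hn : B a a = 2 * n) : K ≃ₗ[ℤ] K :=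
  LinearEquiv.ofLinearMap (eichL B z a n) (eichL B z (-a) n)
    (eichL_inv B hsymm z a n hz hza hn)
    (by
      have := eichL_inv B hsymm z (-a) n hz (by simp [hza]) (by simp [hn])
      rwa [neg_neg] at this)

lemma eich_apply (B : K →ₗ[ℤ] K →ₗ[ℤ] ℤ) (hsymm : ∀ x y, B x y = B y x) (z a : K) (n : ℤ)
    (hz : B z z = 0) (hza : B z a = 0) (hn : B a a = 2 * n) (v : K) :
    eich B hsymm z a n hz hza hn v = v - B a v • z + B z v • a - (n * B z v) • z :=
  eichL_apply B z a n v

lemma eich_oplus (B : K →ₗ[ℤ] K →ₗ[ℤ] ℤ) (hsymm : ∀ x y, B x y = B y x) (z a : K) (n : ℤ)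
    (hz : B z z = 0) (hza : B z a = 0) (hn : B a a = 2 * n) :
    IsOPlus B (eich B hsymm z a n hz hza hn) := by
  have haz : B a z = 0 := by rw [hsymm]; exact hza
  refine ⟨fun x y => ?_, ?_⟩
  · have h1 := hsymm x z
    have h2 := hsymm x a
    simp only [eich_apply, map_add, map_sub, map_smul, LinearMap.add_apply, LinearMap.sub_apply,
      LinearMap.smul_apply, smul_eq_mul, hz, hza, haz, hn, h1, h2]
    ring
  · refine orient_transv _ (bc_symm B hsymm) ((1:ℝ) ⊗ₜ[ℤ] z) ((1:ℝ) ⊗ₜ[ℤ] a) (n : ℝ)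
      ?_ ?_ ?_ _ ?_
    · simp [LinearMap.BilinForm.baseChange_tmul, hz]
    · simp [LinearMap.BilinForm.baseChange_tmul, hza]
    · simp [LinearMap.BilinForm.baseChange_tmul, hn]
    · intro v
      induction v with
      | zero => simp
      | add x1 x2 h1 h2 =>
        simp only [map_add, h1, h2]
        module
      | tmul b m =>
        rw [LinearMap.baseChange_tmul, LinearEquiv.coe_coe, eich_apply]
        have hk : ∀ (k : ℤ) (y : K), b ⊗ₜ[ℤ] (k • y) = (b * (k : ℝ)) • ((1 : ℝ) ⊗ₜ[ℤ] y) := by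
          intro k y
          rw [TensorProduct.tmul_smul, TensorProduct.smul_tmul', TensorProduct.smul_tmul']
          congr 1
          simp [mul_comm]
        simp only [LinearMap.BilinForm.baseChange_tmul, TensorProduct.tmul_sub,
          TensorProduct.tmul_add, hk]
        simp only [zsmul_eq_mul, smul_eq_mul, mul_one, one_mul, Int.cast_mul]
        module

/-- Diagonalisation of a quadruple by the elementary operations. -/
lemma diag_ind (P : ℤ → ℤ → ℤ → ℤ → Prop)
    (h1 : ∀ k a b c d, P (a - k * d) b (c + k * b) d → P a b c d)
    (h2 : ∀ k a b c d, P a (b - k * d) (c + k * a) d → P a b c d)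
    (h3 : ∀ k a b c d, P (a - k * c) b c (d + k * b) → P a b c d)
    (h4 : ∀ k a b c d, P a (b - k * c) c (d + k * a) → P a b c d)
    (hb : ∀ a b, P a b 0 0) : ∀ a b c d, P a b c d := by
  have main : ∀ N : ℕ, ∀ a b c d : ℤ, a ≠ 0 → a.natAbs ≤ N → P a b c d := by
    intro N
    induction N with
    | zero => intro a b c d ha hN; omega
    | succ N ih =>
      intro a b c d ha hN
      have hlt : ∀ x : ℤ, (x % a).natAbs ≤ N := fun x => by
        have e1 := Int.emod_lt_abs x ha
        have e2 := Int.emod_nonneg x ha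
        zify
        rw [abs_of_nonneg e2]
        have e3 : |a| ≤ N + 1 := by rw [Int.abs_eq_natAbs]; exact_mod_cast hN
        linarith
      by_cases hd : d % a = 0
      · by_cases hc : c % a = 0
        · apply h4 (-(d / a))
          have e1 : d + -(d / a) * a = 0 := by
            have := Int.emod_add_mul_ediv d a
            linarith [mul_comm a (d / a)]
          rw [e1]
          apply h2 (-(c / a))
          have e2 : c + -(c / a) * a = 0 := by
            have := Int.emod_add_mul_ediv c a
            linarith [mul_comm a (c / a)]
          rw [e2]
          apply hb
        · apply h2 (-(c / a))
          have e2 : c + -(c / a) * a = c % a := by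
            have := Int.emod_add_mul_ediv c a
            linarith [mul_comm a (c / a)]
          rw [e2]
          apply h3 (-1)
          apply h2 (-1)
          apply h3 (-1)
          apply ih
          · intro h; apply hc; linarith
          · convert hlt c using 2
            ring
      · apply h4 (-(d / a))
        have e2 : d + -(d / a) * a = d % a := by
          have := Int.emod_add_mul_ediv d a
          linarith [mul_comm a (d / a)]
        rw [e2]
        apply h1 (-1)
        apply h4 (-1)
        apply h1 (-1)
        apply ih
        · intro h; apply hd; linarith
        · convert hlt d using 2
          ring
  intro a b c d
  by_cases ha : a = 0
  · by_cases hd : d = 0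
    · by_cases hc : c = 0
      · subst hd hc; apply hb
      · apply h3 1
        exact main _ _ _ _ _ (by omega) le_rfl
    · apply h1 1
      exact main _ _ _ _ _ (by omega) le_rfl
  · exact main _ _ _ _ _ ha le_rfl



lemma closure_oplus (B : K →ₗ[ℤ] K →ₗ[ℤ] ℤ) (hsymm : ∀ x y, B x y = B y x)
    (Q : (K ≃ₗ[ℤ] K) → Prop) (g : K ≃ₗ[ℤ] K)
    (hg : g ∈ Subgroup.closure {g : K ≃ₗ[ℤ] K | IsOPlus B g ∧ Q g}) : IsOPlus B g := by
  induction hg using Subgroup.closure_induction with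
  | mem x hx => exact hx.1
  | one => exact oplus_one B
  | mul x y _ _ hx hy => exact oplus_mul B hsymm x y hx hy
  | inv x _ hx => exact oplus_inv B hsymm x hx

/-- If a subgroup contains the transvections fixing `e + r f` or `e + (r-1) f`, it contains
the transvections attached to `z` and multiples of `e` or `f`. -/
lemma transv_mem (B : K →ₗ[ℤ] K →ₗ[ℤ] ℤ) (hsymm : ∀ x y, B x y = B y x)
    (e f : K) (hee : B e e = 0) (hff : B f f = 0) (hef : B e f = 1) (r : ℤ)
    (G : Subgroup (K ≃ₗ[ℤ] K))
    (hG : ∀ g : K ≃ₗ[ℤ] K, IsOPlus B g →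
      (g (e + r • f) = e + r • f ∨ g (e + (r - 1) • f) = e + (r - 1) • f) → g ∈ G)
    (z : K) (hz : B z z = 0) (hze : B z e = 0) (hzf : B z f = 0) (k : ℤ) :
    (∃ g ∈ G, ∀ v, g v = v - (k * B e v) • z + (k * B z v) • e) ∧
    (∃ g ∈ G, ∀ v, g v = v - (k * B f v) • z + (k * B z v) • f) := by
  have hfe : B f e = 1 := by rw [hsymm]; exact hef
  have hez : B e z = 0 := by rw [hsymm]; exact hze
  have hfz : B f z = 0 := by rw [hsymm]; exact hzf
  have A : ∀ (c k : ℤ), (c = r ∨ c = r - 1) → ∃ g ∈ G, ∀ v, g v =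
      v - (k * B e v - k * c * B f v) • z + (k * B z v) • e - (k * c * B z v) • f
        + (k ^ 2 * c * B z v) • z := by
    intro c k hc
    have e1 : B z (k • (e - c • f)) = 0 := by
      simp only [map_smul, map_sub, hze, hzf]; simp
    have e2 : B (k • (e - c • f)) (k • (e - c • f)) = 2 * (-(k ^ 2 * c)) := by
      simp only [map_smul, map_sub, LinearMap.smul_apply, LinearMap.sub_apply, smul_eq_mul, hee,
        hff, hef, hfe]
      ring
    refine ⟨eich B hsymm z (k • (e - c • f)) (-(k ^ 2 * c)) hz e1 e2, ?_, ?_⟩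
    · apply hG _ (eich_oplus B hsymm z _ _ hz e1 e2)
      have : eich B hsymm z (k • (e - c • f)) (-(k ^ 2 * c)) hz e1 e2 (e + c • f) = e + c • f := by
        rw [eich_apply]
        simp only [map_smul, map_add, map_sub, LinearMap.smul_apply, LinearMap.sub_apply,
          smul_eq_mul, hee, hff, hef, hfe, hze, hzf]
        module
      rcases hc with rfl | rfl
      · exact Or.inl this
      · exact Or.inr this
    · intro v
      rw [eich_apply]
      simp only [map_smul, map_sub, LinearMap.smul_apply, LinearMap.sub_apply, smul_eq_mul]
      module
  have F : ∀ k : ℤ, ∃ g ∈ G, ∀ v, g v = v - (k * B f v) • z + (k * B z v) • f := by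
    intro k
    obtain ⟨g1, hg1, h1⟩ := A (r - 1) k (Or.inr rfl)
    obtain ⟨g2, hg2, h2⟩ := A r (-k) (Or.inl rfl)
    refine ⟨g1 * g2, G.mul_mem hg1 hg2, fun v => ?_⟩
    rw [LinearEquiv.mul_apply, h1, h2]
    simp only [map_add, map_sub, map_smul, smul_eq_mul, hee, hff, hef, hfe, hze, hzf, hez, hfz, hz]
    module
  refine ⟨?_, F k⟩
  obtain ⟨g1, hg1, h1⟩ := A r k (Or.inl rfl)
  obtain ⟨g2, hg2, h2⟩ := F (k * r)
  refine ⟨g1 * g2, G.mul_mem hg1 hg2, fun v => ?_⟩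
  rw [LinearEquiv.mul_apply, h1, h2]
  simp only [map_add, map_sub, map_smul, smul_eq_mul, hee, hff, hef, hfe, hze, hzf, hez, hfz, hz]
  module

lemma main_aux (B : K →ₗ[ℤ] K →ₗ[ℤ] ℤ)
    (hsymm : ∀ x y, B x y = B y x)
    (heven : ∀ x, Even (B x x))
    (e f e₂ f₂ : K)
    (hee : B e e = 0) (hff : B f f = 0) (hef : B e f = 1)
    (he₂e₂ : B e₂ e₂ = 0) (hf₂f₂ : B f₂ f₂ = 0) (he₂f₂ : B e₂ f₂ = 1)
    (h12 : B e e₂ = 0 ∧ B e f₂ = 0 ∧ B f e₂ = 0 ∧ B f f₂ = 0)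
    (r : ℤ) (G : Subgroup (K ≃ₗ[ℤ] K))
    (hGO : ∀ g ∈ G, IsOPlus B g)
    (hG : ∀ g : K ≃ₗ[ℤ] K, IsOPlus B g →
      (g (e + r • f) = e + r • f ∨ g (e + (r - 1) • f) = e + (r - 1) • f) → g ∈ G)
    (g : K ≃ₗ[ℤ] K) (hg : IsOPlus B g) : g ∈ G := by
  obtain ⟨hee₂, hef₂, hfe₂, hff₂⟩ := h12
  have hfe : B f e = 1 := by rw [hsymm]; exact hef
  have hf₂e₂ : B f₂ e₂ = 1 := by rw [hsymm]; exact he₂f₂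
  have he₂e : B e₂ e = 0 := by rw [hsymm]; exact hee₂
  have he₂f : B e₂ f = 0 := by rw [hsymm]; exact hfe₂
  have hf₂e : B f₂ e = 0 := by rw [hsymm]; exact hef₂
  have hf₂f : B f₂ f = 0 := by rw [hsymm]; exact hff₂
  let Good : K → Prop := fun v => B v v = 2 * r → (∃ w, B v w = 1) → ∃ k ∈ G, k v = e + r • f
  have good_of : ∀ k ∈ G, ∀ v, Good (k v) → Good v := by
    intro k hk v hv h1 ⟨w, hw⟩
    obtain ⟨k', hk', h2⟩ := hv (by rw [(hGO k hk).1]; exact h1)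
      ⟨k w, by rw [(hGO k hk).1]; exact hw⟩
    exact ⟨k' * k, G.mul_mem hk' hk, h2⟩
  have opE : ∀ z : K, B z z = 0 → B z e = 0 → B z f = 0 → ∀ (k : ℤ) (v : K),
      Good (v - (k * B e v) • z + (k * B z v) • e) → Good v := by
    intro z hz hze hzf k v h
    obtain ⟨g, hg, h1⟩ := (transv_mem B hsymm e f hee hff hef r G hG z hz hze hzf k).1
    exact good_of g hg v (by rw [h1]; exact h)
  have opF : ∀ z : K, B z z = 0 → B z e = 0 → B z f = 0 → ∀ (k : ℤ) (v : K),
      Good (v - (k * B f v) • z + (k * B z v) • f) → Good v := by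
    intro z hz hze hzf k v h
    obtain ⟨g, hg, h1⟩ := (transv_mem B hsymm e f hee hff hef r G hG z hz hze hzf k).2
    exact good_of g hg v (by rw [h1]; exact h)
  -- vectors without component outside the two hyperbolic planes, first coordinate one
  have good0 : ∀ b : ℤ, Good (e + b • f) := by
    intro b h1 _
    refine ⟨1, G.one_mem, ?_⟩
    simp only [map_add, map_smul, LinearMap.add_apply, LinearMap.smul_apply, smul_eq_mul, hee, hff,
      hef, hfe] at h1
    have : b = r := by linarith
    rw [this]; rfl
  have coords : ∀ l : K, B l e = 0 → B l f = 0 → B l e₂ = 0 → B l f₂ = 0 →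
      ∀ a b c d : ℤ, Good (a • e + b • f + c • e₂ + d • f₂ + l) := by
    intro l hle hlf hle₂ hlf₂
    have hel : B e l = 0 := by rw [hsymm]; exact hle
    have hfl : B f l = 0 := by rw [hsymm]; exact hlf
    have he₂l : B e₂ l = 0 := by rw [hsymm]; exact hle₂
    have hf₂l : B f₂ l = 0 := by rw [hsymm]; exact hlf₂
    have H1 : ∀ k a b c d : ℤ,
        Good ((a - k * d) • e + b • f + (c + k * b) • e₂ + d • f₂ + l) →
        Good (a • e + b • f + c • e₂ + d • f₂ + l) := by
      intro k a b c d h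
      apply opE e₂ he₂e₂ he₂e he₂f (-k)
      convert h using 1
      simp only [map_add, map_smul, smul_eq_mul, *]
      module
    have H2 : ∀ k a b c d : ℤ,
        Good (a • e + (b - k * d) • f + (c + k * a) • e₂ + d • f₂ + l) →
        Good (a • e + b • f + c • e₂ + d • f₂ + l) := by
      intro k a b c d h
      apply opF e₂ he₂e₂ he₂e he₂f (-k)
      convert h using 1
      simp only [map_add, map_smul, smul_eq_mul, *]
      module
    have H3 : ∀ k a b c d : ℤ,
        Good ((a - k * c) • e + b • f + c • e₂ + (d + k * b) • f₂ + l) →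
        Good (a • e + b • f + c • e₂ + d • f₂ + l) := by
      intro k a b c d h
      apply opE f₂ hf₂f₂ hf₂e hf₂f (-k)
      convert h using 1
      simp only [map_add, map_smul, smul_eq_mul, *]
      module
    have H4 : ∀ k a b c d : ℤ,
        Good (a • e + (b - k * c) • f + c • e₂ + (d + k * a) • f₂ + l) →
        Good (a • e + b • f + c • e₂ + d • f₂ + l) := by
      intro k a b c d h
      apply opF f₂ hf₂f₂ hf₂e hf₂f (-k)
      convert h using 1
      simp only [map_add, map_smul, smul_eq_mul, *]
      module
    -- first coordinate one
    have G1 : ∀ b c d : ℤ, Good ((1 : ℤ) • e + b • f + c • e₂ + d • f₂ + l) := by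
      intro b c d
      obtain ⟨n, hn⟩ := heven l
      have hz : B (l + e₂ - n • f₂) (l + e₂ - n • f₂) = 0 := by
        simp only [map_add, map_sub, map_smul, LinearMap.add_apply, LinearMap.sub_apply,
          LinearMap.smul_apply, smul_eq_mul, hn, hle₂, hlf₂, he₂l, hf₂l, he₂e₂, he₂f₂, hf₂e₂, hf₂f₂]
        ring
      refine opF (l + e₂ - n • f₂) hz (by simp [*]) (by simp [*]) 1 _ ?_
      refine opF e₂ he₂e₂ he₂e he₂f (c - 1) _ ?_
      refine opF f₂ hf₂f₂ hf₂e hf₂f (d + n) _ ?_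
      have h0 := good0 (b + (B l l + c * B e₂ e₂ + d - n * c) + (c - 1) * (d + n))
      convert h0 using 1
      simp only [map_add, map_sub, map_smul, LinearMap.add_apply, LinearMap.sub_apply,
          LinearMap.smul_apply, smul_eq_mul, hn, hle, hlf, hel, hfl, hle₂, hlf₂, he₂l, hf₂l, he₂e₂,
          he₂f₂, hf₂e₂, hf₂f₂, hee, hef, hfe, hff, hee₂, hef₂, hfe₂, hff₂, he₂e, he₂f, hf₂e, hf₂f]
      module
    refine diag_ind (fun a b c d => Good (a • e + b • f + c • e₂ + d • f₂ + l)) H1 H2 H3 H4 ?_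
    intro a b hnorm ⟨w, hw⟩
    -- component of `w` in the complement
    let m : K := w - B w f • e - B w e • f - B w f₂ • e₂ - B w e₂ • f₂
    have hme : B m e = 0 := by simp [m, *]
    have hmf : B m f = 0 := by simp [m, *]
    have hme₂ : B m e₂ = 0 := by simp [m, *]
    have hmf₂ : B m f₂ = 0 := by simp [m, *]
    have hlm : a * B w e + b * B w f + B m l = 1 := by
      have e1 := hsymm w e
      have e2 := hsymm w f
      have e3 := hsymm w l
      simp only [map_add, map_smul, LinearMap.add_apply, LinearMap.smul_apply, smul_eq_mul] at hw
      simp only [m, map_sub, map_smul, LinearMap.sub_apply, LinearMap.smul_apply, smul_eq_mul, hel,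
        hfl, he₂l, hf₂l, e1, e2, e3]
      linarith
    obtain ⟨n, hn⟩ := heven m
    have he₂m : B e₂ m = 0 := by rw [hsymm]; exact hme₂
    have hn' : B m m = 2 * n := by rw [hn]; ring
    have hmem : eich B hsymm e₂ m n he₂e₂ he₂m hn' ∈ G := by
      apply hG _ (eich_oplus B hsymm e₂ m n he₂e₂ he₂m hn')
      left
      rw [eich_apply]
      simp only [map_add, map_smul, smul_eq_mul, hme, hmf, he₂e, he₂f]
      module
    have fin : Good (a • e + b • f + (0:ℤ) • e₂ + (0:ℤ) • f₂ + l) := by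
      apply good_of _ hmem
      have e1 : eich B hsymm e₂ m n he₂e₂ he₂m hn' (a • e + b • f + (0:ℤ) • e₂ + (0:ℤ) • f₂ + l)
          = a • e + b • f + (- B m l) • e₂ + (0:ℤ) • f₂ + l := by
        rw [eich_apply]
        simp only [map_add, map_smul, smul_eq_mul, hme, hmf, he₂e, he₂f, hme₂, hmf₂, he₂l]
        module
      rw [e1]
      apply H2 (- B w e)
      apply H1 (- B w f)
      apply H3 (1 - a)
      have e2 : a - -(B w) f * 0 - (1 - a) * (-(B m) l + -(B w) e * a
          + -(B w) f * (b - -(B w) e * 0)) = 1 := by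
        have : -(B m) l + -(B w) e * a + -(B w) f * (b - -(B w) e * 0) = -1 := by linarith
        rw [this]; ring
      rw [e2]
      apply G1
    exact fin hnorm ⟨w, hw⟩
  have all : ∀ v, Good v := by
    intro v
    have h := coords (v - B v f • e - B v e • f - B v f₂ • e₂ - B v e₂ • f₂) (by simp [*])
      (by simp [*]) (by simp [*]) (by simp [*]) (B v f) (B v e) (B v f₂) (B v e₂)
    convert h using 1
    module
  obtain ⟨k, hk, h⟩ := all (g (e + r • f)) (by
      rw [hg.1]
      simp only [map_add, map_smul, LinearMap.add_apply, LinearMap.smul_apply, smul_eq_mul, hee,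
        hff, hef, hfe]
      ring) ⟨g f, by rw [hg.1]; simp [*]⟩
  have h1 : k * g ∈ G := hG _ (oplus_mul B hsymm k g (hGO k hk) hg) (Or.inl h)
  exact (G.mul_mem_cancel_left hk).1 h1

end LatticePart

/-- let `Λ = U ⊕ Λ₁` be an even lattice containing three orthogonal
copies of the hyperbolic plane `U`, with standard basis `{e,f}` of the distinguished
copy. For integers `s, r, p > 1` set `h₁ = e + r·f`, `h₂ = e + (r−1)·f`,
`h₃ = s·e + p·f`, `h₄ = (s−1)·e + p·f`. Then `O⁺(Λ)` is generated by the stabilizer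
subgroups `O⁺(Λ)_{h₁}, O⁺(Λ)_{h₂}, O⁺(Λ)_{h₃}, O⁺(Λ)_{h₄}`. -/
theorem oplus_generated_by_stabilizers
    [Module.Free ℤ M] [Module.Finite ℤ M]
    (B : M →ₗ[ℤ] M →ₗ[ℤ] ℤ)
    (hsymm : ∀ x y, B x y = B y x)
    (heven : ∀ x, Even (B x x))
    (hnd : ∀ x : M, (∀ y, B x y = 0) → x = 0)
    -- three orthogonal hyperbolic pairs `(e,f)`, `(e₂,f₂)`, `(e₃,f₃)` in `M`,
    -- the first one spanning the distinguished summand `U` (which splits off,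
    -- being unimodular), the other two lying in `Λ₁ = U^⊥`
    (e f e₂ f₂ e₃ f₃ : M)
    (hee : B e e = 0) (hff : B f f = 0) (hef : B e f = 1)
    (he₂e₂ : B e₂ e₂ = 0) (hf₂f₂ : B f₂ f₂ = 0) (he₂f₂ : B e₂ f₂ = 1)
    (he₃e₃ : B e₃ e₃ = 0) (hf₃f₃ : B f₃ f₃ = 0) (he₃f₃ : B e₃ f₃ = 1)
    (h12 : B e e₂ = 0 ∧ B e f₂ = 0 ∧ B f e₂ = 0 ∧ B f f₂ = 0)
    (h13 : B e e₃ = 0 ∧ B e f₃ = 0 ∧ B f e₃ = 0 ∧ B f f₃ = 0)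
    (h23 : B e₂ e₃ = 0 ∧ B e₂ f₃ = 0 ∧ B f₂ e₃ = 0 ∧ B f₂ f₃ = 0)
    (s r p : ℤ) (hs : 1 < s) (hr : 1 < r) (hp : 1 < p) :
    let h₁ : M := e + r • f
    let h₂ : M := e + (r - 1) • f
    let h₃ : M := s • e + p • f
    let h₄ : M := (s - 1) • e + p • f
    {g : M ≃ₗ[ℤ] M | IsOPlus B g} =
      ↑(Subgroup.closure
        {g : M ≃ₗ[ℤ] M | IsOPlus B g ∧
          (g h₁ = h₁ ∨ g h₂ = h₂ ∨ g h₃ = h₃ ∨ g h₄ = h₄)}) := by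
  intro h₁ h₂ h₃ h₄
  rename_i _ instM _ _
  obtain rfl : instM = AddCommGroup.toIntModule M := Subsingleton.elim _ _
  ext g
  constructor
  · intro hg
    refine main_aux B hsymm heven e f e₂ f₂ hee hff hef he₂e₂ hf₂f₂ he₂f₂ h12 r _
      (fun k hk => closure_oplus B hsymm _ k hk) ?_ g hg
    intro k hk h
    apply Subgroup.subset_closure
    refine ⟨hk, ?_⟩
    rcases h with h | h
    · exact Or.inl h
    · exact Or.inr (Or.inl h)
  · intro hg
    exact closure_oplus B hsymm _ g hg
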